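/- Let H be an infinite-dimensional separable complex Hilbert space, let V be a finite-dimensional subspace of L¹(B(H)), and let x ∈ L¹(B(H)) \ V. Then y₀ ∈ V is a best approximation to x out of V (i.e., ‖x − y₀‖₁ = dist₁(x,V)) if and only if M_{x−y₀} ∩ N_V ≠ ∅, where for z ∈ L¹(B(H)), M_z := { a ∈ B(H) : ‖a‖ = 1, Tr(az) = ‖z‖₁ }. -/

import Mathlib

open scoped InnerProductSpace

/-- The absolute value `|a| = sqrt (a* a)` of a bounded operator, via the
continuous functional calculus. -/
noncomputable def opAbs {H : Type*} [NormedAddCommGroup H] [InnerProductSpace ℂ H]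
    [CompleteSpace H] (a : H →L[ℂ] H) : H →L[ℂ] H :=
  CFC.sqrt (ContinuousLinearMap.adjoint a * a)

/-- The trace of an operator computed along a fixed Hilbert basis (for trace class
operators this is basis-independent and is the usual trace). -/
noncomputable def traceAlong {H : Type*} [NormedAddCommGroup H] [InnerProductSpace ℂ H]
    [CompleteSpace H] (b : HilbertBasis ℕ ℂ H) (a : H →L[ℂ] H) : ℂ :=
  ∑' n, ⟪b n, a (b n)⟫_ℂ

/-- `a` is trace class: `∑ ⟨eₙ, |a| eₙ⟩ < ∞` (basis-independent for the positive
operator `|a|`). -/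
def IsTraceClass {H : Type*} [NormedAddCommGroup H] [InnerProductSpace ℂ H]
    [CompleteSpace H] (b : HilbertBasis ℕ ℂ H) (a : H →L[ℂ] H) : Prop :=
  Summable fun n => (⟪b n, opAbs a (b n)⟫_ℂ).re

/-- The trace norm `‖a‖₁ = Tr |a|`. -/
noncomputable def traceNorm {H : Type*} [NormedAddCommGroup H] [InnerProductSpace ℂ H]
    [CompleteSpace H] (b : HilbertBasis ℕ ℂ H) (a : H →L[ℂ] H) : ℝ :=
  ∑' n, (⟪b n, opAbs a (b n)⟫_ℂ).re

open Filter Topology ContinuousLinearMap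

lemma HilbertBasis.hasSum_norm_inner_sq {ι H : Type*} [NormedAddCommGroup H]
    [InnerProductSpace ℂ H] (b : HilbertBasis ι ℂ H) (ξ : H) :
    HasSum (fun n => ‖⟪b n, ξ⟫_ℂ‖ ^ 2) (‖ξ‖ ^ 2) := by
  have h := (b.hasSum_inner_mul_inner ξ ξ).mapL Complex.reCLM
  convert! h using 1
  · ext n
    rw [← inner_conj_symm ξ (b n), Complex.conj_mul']
    simp [← Complex.ofReal_pow]
  · exact (inner_self_eq_norm_sq (𝕜 := ℂ) ξ).symm

section OperatorTheory

variable {H : Type*} [NormedAddCommGroup H] [InnerProductSpace ℂ H] [CompleteSpace H]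

lemma opAbs_nonneg (z : H →L[ℂ] H) : 0 ≤ opAbs z := CFC.sqrt_nonneg _

lemma opAbs_mul_self (z : H →L[ℂ] H) : opAbs z * opAbs z = adjoint z * z :=
  CFC.sqrt_mul_sqrt_self _ (star_mul_self_nonneg z)

lemma adjoint_eq_self_of_nonneg {t : H →L[ℂ] H} (ht : 0 ≤ t) : adjoint t = t :=
  (IsSelfAdjoint.of_nonneg ht).adjoint_eq

lemma norm_opAbs_apply (z : H →L[ℂ] H) (ξ : H) : ‖opAbs z ξ‖ = ‖z ξ‖ := by
  have h : ⟪opAbs z ξ, opAbs z ξ⟫_ℂ = ⟪z ξ, z ξ⟫_ℂ := by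
    rw [← adjoint_inner_right, ← adjoint_inner_right,
      adjoint_eq_self_of_nonneg (opAbs_nonneg z)]
    exact congrArg (fun a : H →L[ℂ] H => ⟪ξ, a ξ⟫_ℂ) (opAbs_mul_self z)
  rw [inner_self_eq_norm_sq_to_K, inner_self_eq_norm_sq_to_K] at h
  exact (sq_eq_sq₀ (norm_nonneg _) (norm_nonneg _)).1 (by exact_mod_cast h)

/-- A contraction that acts isometrically on the range of `t` is inverted there by its adjoint. -/
lemma adjoint_apply_apply_of_norm_eq {u : H →L[ℂ] H} (hu : ‖u‖ ≤ 1) {η : H}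
    (h : ‖u η‖ = ‖η‖) : adjoint u (u η) = η := by
  rw [← sub_eq_zero, ← norm_eq_zero, ← sq_eq_zero_iff]
  refine le_antisymm ?_ (sq_nonneg _)
  have h1 : ‖adjoint u (u η)‖ ≤ ‖η‖ := by
    calc ‖adjoint u (u η)‖ ≤ ‖adjoint u‖ * ‖u η‖ := le_opNorm _ _
      _ ≤ 1 * ‖η‖ := by
        rw [h]; gcongr; rwa [LinearIsometryEquiv.norm_map]
      _ = ‖η‖ := one_mul _
  have h2 : RCLike.re ⟪adjoint u (u η), η⟫_ℂ = ‖η‖ ^ 2 := by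
    rw [adjoint_inner_left, inner_self_eq_norm_sq, h]
  rw [@norm_sub_sq ℂ, h2]
  nlinarith [norm_nonneg (adjoint u (u η))]

/-- Polar decomposition: `z = u |z|` and `|z| = u* z` for some contraction `u`. -/
lemma exists_polar_decomposition (z : H →L[ℂ] H) :
    ∃ u : H →L[ℂ] H, ‖u‖ ≤ 1 ∧ u * opAbs z = z ∧ adjoint u * z = opAbs z := by
  set t := opAbs z
  let K : Submodule ℂ H := (LinearMap.range t.toLinearMap).topologicalClosure
  have hK : ∀ ξ, t ξ ∈ K := fun ξ => Submodule.le_topologicalClosure _ ⟨ξ, rfl⟩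
  have : CompleteSpace K :=
    (Submodule.isClosed_topologicalClosure _).completeSpace_coe
  let e : H →ₗ[ℂ] K := t.toLinearMap.codRestrict K hK
  have he : DenseRange e := by
    intro η
    rw [mem_closure_iff_seq_limit]
    obtain ⟨ys, hys, hlim⟩ := mem_closure_iff_seq_limit.1 (show (η : H) ∈ closure _ from η.2)
    choose f hf using hys
    refine ⟨fun n => e (f n), fun n => ⟨_, rfl⟩, ?_⟩
    rw [tendsto_subtype_rng]
    convert! hlim using 2 with n
    exact hf n
  have hb : ∀ ξ, ‖z.toLinearMap ξ‖ ≤ 1 * ‖e ξ‖ := fun ξ => by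
    rw [one_mul]; exact (norm_opAbs_apply z ξ).ge
  let u : H →L[ℂ] H := (z.toLinearMap.extendOfNorm e).comp K.orthogonalProjectionOnto
  have hu : ‖u‖ ≤ 1 := by
    refine (opNorm_comp_le _ _).trans ?_
    exact mul_le_one₀ (LinearMap.opNorm_extendOfNorm_le he zero_le_one hb) (norm_nonneg _)
      K.orthogonalProjectionOnto_norm_le
  have hut : ∀ ξ, u (t ξ) = z ξ := fun ξ => by
    have : K.orthogonalProjectionOnto (t ξ) = e ξ :=
      K.orthogonalProjectionOnto_mem_subspace_eq_self (e ξ)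
    simp only [u, comp_apply, this]
    exact LinearMap.extendOfNorm_eq he ⟨1, hb⟩ ξ
  refine ⟨u, hu, ?_, ?_⟩
  · ext ξ; exact hut ξ
  · ext ξ
    rw [mul_apply_eq_comp, ← hut]
    refine adjoint_apply_apply_of_norm_eq hu ?_
    rw [hut, norm_opAbs_apply]

/-- An operator and its adjoint have the same Hilbert–Schmidt norm. -/
lemma HilbertBasis.hasSum_norm_adjoint_sq {ι : Type*} (b : HilbertBasis ι ℂ H) (t : H →L[ℂ] H)
    (ht : Summable fun n => ‖t (b n)‖ ^ 2) :
    HasSum (fun n => ‖adjoint t (b n)‖ ^ 2) (∑' n, ‖t (b n)‖ ^ 2) := by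
  let f : ι × ι → ℝ := fun p => ‖⟪b p.2, t (b p.1)⟫_ℂ‖ ^ 2
  have h1 : ∀ n, HasSum (fun m => f (n, m)) (‖t (b n)‖ ^ 2) := fun n =>
    b.hasSum_norm_inner_sq (t (b n))
  have h2 : ∀ m, HasSum (fun n => f (n, m)) (‖adjoint t (b m)‖ ^ 2) := fun m => by
    convert! b.hasSum_norm_inner_sq (adjoint t (b m)) using 2 with n
    simp only [f]
    rw [adjoint_inner_right, norm_inner_symm]
  have hf : Summable f := by
    refine (summable_prod_of_nonneg fun _ => sq_nonneg _).2 ⟨fun n => (h1 n).summable, ?_⟩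
    exact ht.congr fun n => (h1 n).tsum_eq.symm
  have h3 : ∑' p, f p = ∑' n, ‖t (b n)‖ ^ 2 :=
    (hf.hasSum.prod_fiberwise h1).tsum_eq.symm
  rw [← h3]
  have hs := (Equiv.prodComm ι ι).hasSum_iff.2 hf.hasSum
  exact hs.prod_fiberwise h2

lemma re_inner_opAbs (z : H →L[ℂ] H) (ξ : H) :
    (⟪ξ, opAbs z ξ⟫_ℂ).re = ‖CFC.sqrt (opAbs z) ξ‖ ^ 2 := by
  set s := CFC.sqrt (opAbs z)
  have h : opAbs z = s * s := (CFC.sqrt_mul_sqrt_self _ (opAbs_nonneg z)).symm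
  have hsa : adjoint s = s := adjoint_eq_self_of_nonneg (CFC.sqrt_nonneg _)
  clear_value s
  rw [h, mul_apply_eq_comp, ← adjoint_inner_left, hsa]
  exact inner_self_eq_norm_sq (𝕜 := ℂ) _

lemma re_inner_opAbs_nonneg (z : H →L[ℂ] H) (ξ : H) : 0 ≤ (⟪ξ, opAbs z ξ⟫_ℂ).re := by
  rw [re_inner_opAbs]; positivity

variable {b : HilbertBasis ℕ ℂ H}

lemma traceNorm_nonneg (z : H →L[ℂ] H) : 0 ≤ traceNorm b z :=
  tsum_nonneg fun _ => re_inner_opAbs_nonneg _ _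

lemma IsTraceClass.sum_norm_inner_le {z : H →L[ℂ] H} (hz : IsTraceClass b z) (a : H →L[ℂ] H)
    (S : Finset ℕ) :
    ∑ n ∈ S, ‖⟪b n, a (z (b n))⟫_ℂ‖ ≤
      ‖a‖ * √(traceNorm b z) * √(∑ n ∈ S, (⟪b n, opAbs z (b n)⟫_ℂ).re) := by
  obtain ⟨u, hu, huz, -⟩ := exists_polar_decomposition z
  unfold traceNorm
  unfold IsTraceClass at hz
  simp only [re_inner_opAbs] at hz ⊢
  set s := CFC.sqrt (opAbs z) with hs
  set c := a * (u * s) with hc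
  have hss : s * s = opAbs z := CFC.sqrt_mul_sqrt_self _ (opAbs_nonneg z)
  have hcz : c * s = a * z := by rw [hc, mul_assoc, mul_assoc, hss, huz]
  have hcs : ∀ n, ‖c (b n)‖ ^ 2 ≤ ‖a‖ ^ 2 * ‖s (b n)‖ ^ 2 := fun n => by
    rw [← mul_pow]
    gcongr
    calc ‖a (u (s (b n)))‖ ≤ ‖a‖ * ‖u (s (b n))‖ := le_opNorm _ _
      _ ≤ ‖a‖ * ‖s (b n)‖ := by
        gcongr; exact u.le_of_opNorm_le_of_le hu le_rfl |>.trans_eq (one_mul _)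
  have hsum : Summable fun n => ‖c (b n)‖ ^ 2 :=
    (hz.mul_left (‖a‖ ^ 2)).of_nonneg_of_le (fun _ => sq_nonneg _) hcs
  have hadj := b.hasSum_norm_adjoint_sq c hsum
  have hle : ∑ n ∈ S, ‖adjoint c (b n)‖ ^ 2 ≤ ‖a‖ ^ 2 * ∑' n, ‖s (b n)‖ ^ 2 := by
    refine (sum_le_hasSum S (fun _ _ => sq_nonneg _) hadj).trans ?_
    rw [← tsum_mul_left]
    exact hsum.tsum_le_tsum hcs (hz.mul_left _)
  calc ∑ n ∈ S, ‖⟪b n, a (z (b n))⟫_ℂ‖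
      ≤ ∑ n ∈ S, ‖adjoint c (b n)‖ * ‖s (b n)‖ := by
        refine Finset.sum_le_sum fun n _ => ?_
        have : a (z (b n)) = c (s (b n)) := congrArg (fun f : H →L[ℂ] H => f (b n)) hcz.symm
        rw [this, ← adjoint_inner_left]
        exact norm_inner_le_norm _ _
    _ ≤ √(∑ n ∈ S, ‖adjoint c (b n)‖ ^ 2) * √(∑ n ∈ S, ‖s (b n)‖ ^ 2) :=
        Real.sum_mul_le_sqrt_mul_sqrt _ _ _
    _ ≤ ‖a‖ * √(∑' n, ‖s (b n)‖ ^ 2) * √(∑ n ∈ S, ‖s (b n)‖ ^ 2) := by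
        gcongr
        refine (Real.sqrt_le_sqrt hle).trans_eq ?_
        rw [Real.sqrt_mul (sq_nonneg _), Real.sqrt_sq (norm_nonneg _)]

lemma IsTraceClass.summable_norm_inner {z : H →L[ℂ] H} (hz : IsTraceClass b z)
    (a : H →L[ℂ] H) : Summable fun n => ‖⟪b n, a (z (b n))⟫_ℂ‖ := by
  refine summable_of_sum_le (c := ‖a‖ * √(traceNorm b z) * √(traceNorm b z))
    (fun _ => norm_nonneg _) fun S => (hz.sum_norm_inner_le a S).trans ?_
  gcongr
  exact hz.sum_le_tsum S fun _ _ => re_inner_opAbs_nonneg _ _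

lemma IsTraceClass.tsum_norm_inner_nat_add_le {z : H →L[ℂ] H} (hz : IsTraceClass b z)
    (a : H →L[ℂ] H) (N : ℕ) :
    ∑' n, ‖⟪b (n + N), a (z (b (n + N)))⟫_ℂ‖ ≤
      ‖a‖ * √(traceNorm b z) * √(∑' n, (⟪b (n + N), opAbs z (b (n + N))⟫_ℂ).re) := by
  refine Real.tsum_le_of_sum_le (fun _ => norm_nonneg _) fun S => ?_
  have h := hz.sum_norm_inner_le a (S.map (addRightEmbedding N))
  simp only [Finset.sum_map, addRightEmbedding_apply] at h
  refine h.trans ?_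
  gcongr
  exact ((summable_nat_add_iff N).2 hz).sum_le_tsum S fun _ _ => re_inner_opAbs_nonneg _ _

lemma IsTraceClass.tsum_norm_inner_le {z : H →L[ℂ] H} (hz : IsTraceClass b z)
    (a : H →L[ℂ] H) : ∑' n, ‖⟪b n, a (z (b n))⟫_ℂ‖ ≤ ‖a‖ * traceNorm b z := by
  refine (hz.tsum_norm_inner_nat_add_le a 0).trans_eq ?_
  rw [mul_assoc]
  congr 1
  exact Real.mul_self_sqrt (traceNorm_nonneg z)

/-- The pairing between bounded and trace class operators is contractive. -/
lemma IsTraceClass.norm_traceAlong_mul_le {z : H →L[ℂ] H} (hz : IsTraceClass b z)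
    (a : H →L[ℂ] H) : ‖traceAlong b (a * z)‖ ≤ ‖a‖ * traceNorm b z :=
  (norm_tsum_le_tsum_norm (hz.summable_norm_inner a)).trans (hz.tsum_norm_inner_le a)

lemma IsTraceClass.traceAlong_mul_add {y z : H →L[ℂ] H} (hy : IsTraceClass b y)
    (hz : IsTraceClass b z) (a : H →L[ℂ] H) :
    traceAlong b (a * (y + z)) = traceAlong b (a * y) + traceAlong b (a * z) := by
  refine Eq.trans (tsum_congr fun n => ?_)
    ((hy.summable_norm_inner a).of_norm.tsum_add (hz.summable_norm_inner a).of_norm)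
  simp only [mul_apply_eq_comp, add_apply, map_add, inner_add_right]

lemma exists_re_inner_opAbs_eq (z : H →L[ℂ] H) :
    ∃ a : H →L[ℂ] H, ‖a‖ ≤ 1 ∧
      ∀ ξ, (⟪ξ, opAbs z ξ⟫_ℂ).re = (⟪ξ, a (z ξ)⟫_ℂ).re := by
  obtain ⟨u, hu, -, huz⟩ := exists_polar_decomposition z
  refine ⟨adjoint u, by rwa [LinearIsometryEquiv.norm_map], fun ξ => ?_⟩
  rw [← huz]; rfl

lemma isTraceClass_zero : IsTraceClass b (0 : H →L[ℂ] H) := by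
  simp [IsTraceClass, opAbs, summable_zero]

lemma traceNorm_zero : traceNorm b (0 : H →L[ℂ] H) = 0 := by
  simp [traceNorm, opAbs]

lemma IsTraceClass.add_and_traceNorm_add_le {y z : H →L[ℂ] H} (hy : IsTraceClass b y)
    (hz : IsTraceClass b z) :
    IsTraceClass b (y + z) ∧ traceNorm b (y + z) ≤ traceNorm b y + traceNorm b z := by
  obtain ⟨a, ha, h⟩ := exists_re_inner_opAbs_eq (y + z)
  have hle : ∀ n, (⟪b n, opAbs (y + z) (b n)⟫_ℂ).re ≤
      ‖⟪b n, a (y (b n))⟫_ℂ‖ + ‖⟪b n, a (z (b n))⟫_ℂ‖ := fun n => by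
    rw [h, add_apply, map_add, inner_add_right]
    exact (Complex.re_le_norm _).trans (norm_add_le _ _)
  have hs := (hy.summable_norm_inner a).add (hz.summable_norm_inner a)
  have hyz : IsTraceClass b (y + z) :=
    hs.of_nonneg_of_le (fun n => re_inner_opAbs_nonneg _ _) hle
  refine ⟨hyz, (hyz.tsum_le_tsum hle hs).trans ?_⟩
  rw [(hy.summable_norm_inner a).tsum_add (hz.summable_norm_inner a)]
  exact add_le_add
    ((hy.tsum_norm_inner_le a).trans (mul_le_of_le_one_left (traceNorm_nonneg _) ha))
    ((hz.tsum_norm_inner_le a).trans (mul_le_of_le_one_left (traceNorm_nonneg _) ha))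

lemma IsTraceClass.smul_and_traceNorm_smul_le {z : H →L[ℂ] H} (hz : IsTraceClass b z) (c : ℂ) :
    IsTraceClass b (c • z) ∧ traceNorm b (c • z) ≤ ‖c‖ * traceNorm b z := by
  obtain ⟨a, ha, h⟩ := exists_re_inner_opAbs_eq (c • z)
  have hle : ∀ n, (⟪b n, opAbs (c • z) (b n)⟫_ℂ).re ≤ ‖c‖ * ‖⟪b n, a (z (b n))⟫_ℂ‖ := fun n => by
    rw [h, smul_apply, map_smul, inner_smul_right, ← norm_mul]
    exact Complex.re_le_norm _
  have hs := (hz.summable_norm_inner a).mul_left ‖c‖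
  have hcz : IsTraceClass b (c • z) :=
    hs.of_nonneg_of_le (fun n => re_inner_opAbs_nonneg _ _) hle
  refine ⟨hcz, (hcz.tsum_le_tsum hle hs).trans ?_⟩
  rw [tsum_mul_left]
  gcongr
  exact (hz.tsum_norm_inner_le a).trans (mul_le_of_le_one_left (traceNorm_nonneg _) ha)

lemma isTraceClass_rankOne_and_traceNorm_le (η ξ : H) :
    IsTraceClass b (InnerProductSpace.rankOne ℂ η ξ) ∧
      traceNorm b (InnerProductSpace.rankOne ℂ η ξ) ≤ ‖η‖ * ‖ξ‖ := by
  obtain ⟨a, ha, h⟩ := exists_re_inner_opAbs_eq (InnerProductSpace.rankOne ℂ η ξ)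
  have hs : HasSum (fun n => (⟪b n, opAbs (InnerProductSpace.rankOne ℂ η ξ) (b n)⟫_ℂ).re)
      (⟪ξ, a η⟫_ℂ).re := by
    convert! (b.hasSum_inner_mul_inner ξ (a η)).mapL Complex.reCLM using 2 with n
    rw [h]
    simp
  refine ⟨hs.summable, hs.tsum_eq.trans_le ?_⟩
  calc (⟪ξ, a η⟫_ℂ).re ≤ ‖ξ‖ * ‖a η‖ := (Complex.re_le_norm _).trans (norm_inner_le_norm _ _)
    _ ≤ ‖ξ‖ * ‖η‖ := by
      gcongr; exact a.le_of_opNorm_le_of_le ha le_rfl |>.trans_eq (one_mul _)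
    _ = ‖η‖ * ‖ξ‖ := mul_comm _ _

lemma IsTraceClass.eq_zero_of_traceNorm_eq_zero {z : H →L[ℂ] H} (hz : IsTraceClass b z)
    (h : traceNorm b z = 0) : z = 0 := by
  have h0 := (hasSum_zero_iff_of_nonneg fun n => re_inner_opAbs_nonneg z (b n)).1
    (show HasSum _ (0 : ℝ) from h ▸ Summable.hasSum hz)
  have hs : ∀ n, z (b n) = 0 := fun n => by
    have h1 := congrFun h0 n
    simp only [Pi.zero_apply, re_inner_opAbs, sq_eq_zero_iff, norm_eq_zero] at h1
    rw [← norm_eq_zero, ← norm_opAbs_apply, ← CFC.sqrt_mul_sqrt_self _ (opAbs_nonneg z),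
      mul_apply_eq_comp, h1, map_zero, norm_zero]
  refine ContinuousLinearMap.ext_on (Submodule.dense_iff_topologicalClosure_eq_top.2 b.dense_span) ?_
  rintro _ ⟨n, rfl⟩
  exact hs n

variable (b) in
/-- The trace class operators as a subspace of the bounded operators. -/
def traceClassSubmodule : Submodule ℂ (H →L[ℂ] H) where
  carrier := {z | IsTraceClass b z}
  zero_mem' := isTraceClass_zero
  add_mem' hy hz := (IsTraceClass.add_and_traceNorm_add_le hy hz).1
  smul_mem' c _ hz := (IsTraceClass.smul_and_traceNorm_smul_le hz c).1

variable (b) in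
/-- The trace norm as a seminorm on the trace class operators. -/
noncomputable def traceSeminorm : Seminorm ℂ (traceClassSubmodule b) :=
  Seminorm.ofSMulLE (fun z => traceNorm b z) traceNorm_zero
    (fun y z => (y.2.add_and_traceNorm_add_le z.2).2)
    (fun c z => (z.2.smul_and_traceNorm_smul_le c).2)

lemma traceSeminorm_apply (z : traceClassSubmodule b) :
    traceSeminorm b z = traceNorm b z := rfl

/-- The rank one operator `η ⟨ξ, ·⟩` as a trace class operator. -/
noncomputable def traceClassRankOne (b : HilbertBasis ℕ ℂ H) (η ξ : H) : traceClassSubmodule b :=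
  ⟨InnerProductSpace.rankOne ℂ η ξ, (isTraceClass_rankOne_and_traceNorm_le η ξ).1⟩

/-- Truncations along the basis approximate a trace class operator in trace norm. -/
lemma tendsto_traceSeminorm_sub_sum (z : traceClassSubmodule b) :
    Tendsto (fun N => traceSeminorm b
      (z - ∑ n ∈ Finset.range N, traceClassRankOne b (z.1 (b n)) (b n))) atTop (𝓝 0) := by
  have hz : IsTraceClass b z.1 := z.2
  have htail : Tendsto (fun N => √(traceNorm b z) *
      √(∑' n, (⟪b (n + N), opAbs z.1 (b (n + N))⟫_ℂ).re)) atTop (𝓝 0) := by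
    have h := (tendsto_sum_nat_add fun n => (⟪b n, opAbs z.1 (b n)⟫_ℂ).re).sqrt.const_mul
      (√(traceNorm b z))
    simpa using h
  refine squeeze_zero (fun _ => apply_nonneg _ _) (fun N => ?_) htail
  set w := z - ∑ n ∈ Finset.range N, traceClassRankOne b (z.1 (b n)) (b n) with hw
  have hwb : ∀ m, w.1 (b m) = if m < N then 0 else z.1 (b m) := fun m => by
    have h : w.1 = z.1 - ∑ n ∈ Finset.range N, InnerProductSpace.rankOne ℂ (z.1 (b n)) (b n) := by
      simp [hw, traceClassRankOne]
    rw [h, sub_apply, sum_apply]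
    simp only [InnerProductSpace.rankOne_apply, orthonormal_iff_ite.1 b.orthonormal, ite_smul,
      one_smul, zero_smul, Finset.sum_ite_eq', Finset.mem_range]
    split_ifs <;> simp
  obtain ⟨a, ha, h⟩ := exists_re_inner_opAbs_eq w.1
  have hwt : IsTraceClass b w.1 := w.2
  rw [traceSeminorm_apply, traceNorm, ← hwt.sum_add_tsum_nat_add N,
    Finset.sum_eq_zero (fun m hm => by rw [h, hwb, if_pos (Finset.mem_range.1 hm)]; simp), zero_add]
  calc ∑' m, (⟪b (m + N), opAbs w.1 (b (m + N))⟫_ℂ).re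
      ≤ ∑' m, ‖⟪b (m + N), a (z.1 (b (m + N)))⟫_ℂ‖ := by
        refine ((summable_nat_add_iff N).2 hwt).tsum_le_tsum (fun m => ?_)
          ((summable_nat_add_iff N).2 (hz.summable_norm_inner a))
        rw [h, hwb, if_neg (by omega)]
        exact Complex.re_le_norm _
    _ ≤ ‖a‖ * √(traceNorm b z.1) * √(∑' n, (⟪b (n + N), opAbs z.1 (b (n + N))⟫_ℂ).re) :=
        hz.tsum_norm_inner_nat_add_le a N
    _ ≤ _ := by
        rw [mul_assoc]
        exact mul_le_of_le_one_left (by positivity) ha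

/-- Every functional bounded by the trace norm is given by a bounded operator. -/
lemma exists_traceAlong_eq (f : traceClassSubmodule b →ₗ[ℂ] ℂ)
    (hf : ∀ z, ‖f z‖ ≤ traceSeminorm b z) :
    ∃ a : H →L[ℂ] H, ‖a‖ ≤ 1 ∧ ∀ z : traceClassSubmodule b, f z = traceAlong b (a * z.1) := by
  have hr : ∀ η ξ, ‖f (traceClassRankOne b η ξ)‖ ≤ ‖η‖ * ‖ξ‖ := fun η ξ =>
    (hf _).trans (isTraceClass_rankOne_and_traceNorm_le η ξ).2
  let B : H →L⋆[ℂ] H →L[ℂ] ℂ := LinearMap.mkContinuous₂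
    (LinearMap.mk₂'ₛₗ (starRingEnd ℂ) (RingHom.id ℂ) (fun ξ η => f (traceClassRankOne b η ξ))
      (fun ξ ξ' η => by rw [← map_add]; congr 1; ext; simp [traceClassRankOne])
      (fun c ξ η => by
        rw [← map_smul]; congr 1; ext; simp [traceClassRankOne])
      (fun ξ η η' => by rw [← map_add]; congr 1; ext; simp [traceClassRankOne])
      (fun c ξ η => by rw [← map_smul]; congr 1; ext; simp [traceClassRankOne])) 1
    (fun ξ η => by simpa [mul_comm] using hr η ξ)
  let T := InnerProductSpace.continuousLinearMapOfBilin B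
  have hT : ∀ ξ η, ⟪T ξ, η⟫_ℂ = f (traceClassRankOne b η ξ) := fun ξ η =>
    InnerProductSpace.continuousLinearMapOfBilin_apply B ξ η
  have hTn : ‖T‖ ≤ 1 := by
    refine T.opNorm_le_bound zero_le_one fun ξ => ?_
    rw [one_mul]
    by_cases h0 : T ξ = 0
    · simp [h0]
    have h1 := hr (T ξ) ξ
    rw [← hT, inner_self_eq_norm_sq_to_K, norm_pow, sq] at h1
    simpa [norm_pos_iff.2 h0] using h1
  refine ⟨adjoint T, by rwa [LinearIsometryEquiv.norm_map], fun z => ?_⟩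
  have hz : IsTraceClass b z.1 := z.2
  have h1 := (hz.summable_norm_inner (adjoint T)).of_norm.hasSum.tendsto_sum_nat
  refine tendsto_nhds_unique ?_ h1
  have h2 := squeeze_zero_norm (fun N => hf _) (tendsto_traceSeminorm_sub_sum z)
  have h3 := tendsto_const_nhds (x := f z) |>.sub h2
  rw [sub_zero] at h3
  refine h3.congr fun N => ?_
  rw [map_sub, sub_sub_cancel, map_sum]
  refine Finset.sum_congr rfl fun n _ => ?_
  rw [← hT, adjoint_inner_right]

end OperatorTheory

/-- Hahn–Banach for a seminorm: a point which is nearest to `0` modulo `V` is normed by a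
functional vanishing on `V`. -/
lemma Seminorm.exists_linearMap_of_le {E : Type*} [AddCommGroup E] [Module ℂ E]
    (p : Seminorm ℂ E) (V : Submodule ℂ E) (z : E) (h : ∀ v ∈ V, p z ≤ p (z - v)) :
    ∃ f : E →ₗ[ℂ] ℂ, (∀ w, ‖f w‖ ≤ p w) ∧ f z = p z ∧ ∀ v ∈ V, f v = 0 := by
  let := AddGroupSeminorm.toSeminormedAddCommGroup p.toAddGroupSeminorm
  let : NormedSpace ℂ E := ⟨fun c w => (map_smul_eq_mul p c w).le⟩
  have hnorm : ∀ w : E, ‖w‖ = p w := fun _ => rfl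
  have hz : ‖(Submodule.Quotient.mk z : E ⧸ V)‖ = p z := by
    refine le_antisymm (Submodule.Quotient.norm_mk_le _ _) ?_
    refine le_of_forall_pos_le_add fun ε hε => ?_
    obtain ⟨w, hw, hlt⟩ := Submodule.Quotient.norm_mk_lt (S := V) (Submodule.Quotient.mk z) hε
    have hv : z - w ∈ V := (Submodule.Quotient.eq V).1 hw.symm
    have := h _ hv
    rw [sub_sub_cancel] at this
    exact this.trans hlt.le
  obtain ⟨g, hg, hgz⟩ := exists_dual_vector'' ℂ (Submodule.Quotient.mk z : E ⧸ V)
  refine ⟨g.toLinearMap.comp V.mkQ, fun w => ?_, ?_, fun v hv => ?_⟩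
  · refine (g.le_of_opNorm_le_of_le hg (Submodule.Quotient.norm_mk_le V w)).trans_eq (one_mul _)
  · rw [← hz]; exact hgz
  · simp [(Submodule.Quotient.mk_eq_zero V).2 hv]

/-- `y₀ ∈ V` is a best approximation to `x` out of `V` in trace
norm iff `M_{x−y₀} ∩ N_V ≠ ∅`, where
`M_z = { a ∈ B(H) : ‖a‖ = 1, Tr(a z) = ‖z‖₁ }`. -/
theorem bestApprox_trace_iff_norming_functional {H : Type*} [NormedAddCommGroup H]
    [InnerProductSpace ℂ H] [CompleteSpace H]
    (hinf : ¬FiniteDimensional ℂ H) (b : HilbertBasis ℕ ℂ H)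
    (V : Submodule ℂ (H →L[ℂ] H)) [FiniteDimensional ℂ V]
    (hV : ∀ v ∈ V, IsTraceClass b v)
    (x : H →L[ℂ] H) (hxt : IsTraceClass b x) (hx : x ∉ V)
    (y₀ : H →L[ℂ] H) (hy₀ : y₀ ∈ V) :
    traceNorm b (x - y₀) = sInf {r : ℝ | ∃ v ∈ V, r = traceNorm b (x - v)} ↔
      ∃ a : H →L[ℂ] H, ‖a‖ = 1 ∧
        traceAlong b (a * (x - y₀)) = ((traceNorm b (x - y₀) : ℝ) : ℂ) ∧
        ∀ y ∈ V, traceAlong b (a * y) = 0 := by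
  have hsub : ∀ v ∈ V, IsTraceClass b (x - v) := fun v hv =>
    (traceClassSubmodule b).sub_mem hxt (hV v hv)
  constructor
  · intro h
    have hbdd : BddBelow {r : ℝ | ∃ v ∈ V, r = traceNorm b (x - v)} :=
      ⟨0, by rintro _ ⟨v, -, rfl⟩; exact traceNorm_nonneg _⟩
    let z : traceClassSubmodule b := ⟨x - y₀, hsub y₀ hy₀⟩
    obtain ⟨f, hf, hfz, hfV⟩ := (traceSeminorm b).exists_linearMap_of_le
      (V.comap (traceClassSubmodule b).subtype) z fun v hv => by
        simp only [traceSeminorm_apply]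
        refine h.trans_le (csInf_le hbdd ⟨y₀ + v.1, V.add_mem hy₀ hv, ?_⟩)
        simp [z, sub_sub]
    obtain ⟨a, ha, hfa⟩ := exists_traceAlong_eq f hf
    have haz : traceAlong b (a * (x - y₀)) = ((traceNorm b (x - y₀) : ℝ) : ℂ) :=
      (hfa z).symm.trans hfz
    refine ⟨a, le_antisymm ha ?_, haz, fun y hy => ?_⟩
    · have hpos : 0 < traceNorm b (x - y₀) := by
        refine (traceNorm_nonneg _).lt_of_ne' fun h0 => hx ?_
        rwa [sub_eq_zero.1 ((hsub y₀ hy₀).eq_zero_of_traceNorm_eq_zero h0)]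
      have hle := (hsub y₀ hy₀).norm_traceAlong_mul_le a
      rw [haz, Complex.norm_real, Real.norm_of_nonneg hpos.le] at hle
      exact (le_mul_iff_one_le_left hpos).1 hle
    · exact (hfa ⟨y, hV y hy⟩).symm.trans (hfV ⟨y, hV y hy⟩ hy)
  · rintro ⟨a, ha, haz, haV⟩
    symm
    refine IsLeast.csInf_eq ⟨⟨y₀, hy₀, rfl⟩, ?_⟩
    rintro _ ⟨v, hv, rfl⟩
    have hvy : v - y₀ ∈ V := V.sub_mem hv hy₀
    have h := (hsub v hv).traceAlong_mul_add (hV _ hvy) a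
    rw [sub_add_sub_cancel, haV _ hvy, add_zero, haz] at h
    have hle := (hsub v hv).norm_traceAlong_mul_le a
    rwa [← h, ha, one_mul, Complex.norm_real, Real.norm_of_nonneg (traceNorm_nonneg _)] at hle
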